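/- A morphism θ : S → T between Boolean inverse ∧-monoids is injective if and only if its kernel θ⁻¹(0) equals {0}. -/

import Mathlib

namespace Coordinatization

/-- The data of a monoid with zero equipped with an inverse operation. -/
structure InvMonData (S : Type) where
  mul : S → S → S
  one : S
  zero : S
  inv : S → S

variable {S T : Type}

/-- `M` is an inverse monoid with zero: a monoid with zero in which every element `a`
has a unique generalized inverse `a⁻¹`. -/
structure IsInverseMonoid (M : InvMonData S) : Prop where
  mul_assoc : ∀ a b c, M.mul (M.mul a b) c = M.mul a (M.mul b c)
  one_mul : ∀ a, M.mul M.one a = a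
  mul_one : ∀ a, M.mul a M.one = a
  zero_mul : ∀ a, M.mul M.zero a = M.zero
  mul_zero : ∀ a, M.mul a M.zero = M.zero
  inv_law₁ : ∀ a, M.mul (M.mul a (M.inv a)) a = a
  inv_law₂ : ∀ a, M.mul (M.mul (M.inv a) a) (M.inv a) = M.inv a
  inv_unique : ∀ a b, M.mul (M.mul a b) a = a → M.mul (M.mul b a) b = b → b = M.inv a

/-- `e` is an idempotent. -/
def IsIdem (M : InvMonData S) (e : S) : Prop := M.mul e e = e

/-- The natural partial order: `a ≤ b` iff `a = b·e` for some idempotent `e`. -/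
def nle (M : InvMonData S) (a b : S) : Prop := ∃ e, IsIdem M e ∧ a = M.mul b e

/-- `a` and `b` are compatible: `a⁻¹b` and `ab⁻¹` are both idempotents. -/
def Compatible (M : InvMonData S) (a b : S) : Prop :=
  IsIdem M (M.mul (M.inv a) b) ∧ IsIdem M (M.mul a (M.inv b))

/-- `a` and `b` are orthogonal: `a⁻¹b = 0 = ab⁻¹`. -/
def Orthogonal (M : InvMonData S) (a b : S) : Prop :=
  M.mul (M.inv a) b = M.zero ∧ M.mul a (M.inv b) = M.zero

/-- `j` is the join of `a` and `b` with respect to the natural partial order. -/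
def IsJoin (M : InvMonData S) (a b j : S) : Prop :=
  nle M a j ∧ nle M b j ∧ ∀ c, nle M a c → nle M b c → nle M j c

/-- `m` is the meet of `a` and `b` with respect to the natural partial order. -/
def IsMeet (M : InvMonData S) (a b m : S) : Prop :=
  nle M m a ∧ nle M m b ∧ ∀ c, nle M c a → nle M c b → nle M c m

/-- Green's relation `D`: `e D f` iff there is `a` with `a⁻¹a = e` and `aa⁻¹ = f`. -/
def DRel (M : InvMonData S) (e f : S) : Prop :=
  ∃ a, M.mul (M.inv a) a = e ∧ M.mul a (M.inv a) = f

/-- `f` is a Boolean complement of the idempotent `e` in the Boolean algebra of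
idempotents: `e·f = 0` and `e ∨ f = 1`. -/
def IsComplPair (M : InvMonData S) (e f : S) : Prop :=
  IsIdem M e ∧ IsIdem M f ∧ M.mul e f = M.zero ∧ IsJoin M e f M.one

/-- A Boolean inverse monoid: an inverse monoid with zero in which the idempotents form a
Boolean algebra under the natural partial order (meets of idempotents are given by products;
complements exist), all compatible binary joins exist, and multiplication distributes over
binary joins. -/
structure IsBooleanInverseMonoid (M : InvMonData S) : Prop where
  invMon : IsInverseMonoid M
  joins_exist : ∀ a b, Compatible M a b → ∃ j, IsJoin M a b j
  mul_join_left : ∀ c a b j, IsJoin M a b j → IsJoin M (M.mul c a) (M.mul c b) (M.mul c j)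
  mul_join_right : ∀ c a b j, IsJoin M a b j → IsJoin M (M.mul a c) (M.mul b c) (M.mul j c)
  compl_exists : ∀ e, IsIdem M e → ∃ f, IsComplPair M e f

/-- The relation `D` preserves complementation: `e D f` implies `ē D f̄`. -/
def DPreservesCompl (M : InvMonData S) : Prop :=
  ∀ e f e' f', DRel M e f → IsComplPair M e e' → IsComplPair M f f' → DRel M e' f'

/-- `M` is completely semisimple: `e D f ≤ e` implies `e = f` for idempotents. -/
def CompletelySemisimple (M : InvMonData S) : Prop :=
  ∀ e f, IsIdem M e → IsIdem M f → DRel M e f → nle M f e → e = f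

/-- A Foulis monoid: a completely semisimple Boolean inverse monoid in which `D`
preserves complementation. -/
def IsFoulis (M : InvMonData S) : Prop :=
  IsBooleanInverseMonoid M ∧ CompletelySemisimple M ∧ DPreservesCompl M

/-- The preorder underlying `S/J`: `Jle s t` iff `SsS ⊆ StS`, i.e. `s = a·t·b` for some `a, b`. -/
def Jle (M : InvMonData S) (s t : S) : Prop := ∃ a b, s = M.mul (M.mul a t) b

/-- `S/J`, the poset of principal ideals, is a lattice. -/
def LatticeCondition (M : InvMonData S) : Prop :=
  ∀ s t : S,
    (∃ m, Jle M m s ∧ Jle M m t ∧ ∀ c, Jle M c s → Jle M c t → Jle M c m) ∧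
    (∃ j, Jle M s j ∧ Jle M t j ∧ ∀ c, Jle M s c → Jle M t c → Jle M j c)

/-- `[e] ⊕ [f] = [g]` in `E(S)/D`: there are orthogonal idempotents `e' D e` and `f' D f`
whose join is `D`-related to `g`. -/
def OplusEq (M : InvMonData S) (e f g : S) : Prop :=
  ∃ e' f' j, IsIdem M e' ∧ IsIdem M f' ∧ DRel M e e' ∧ DRel M f f' ∧
    M.mul e' f' = M.zero ∧ IsJoin M e' f' j ∧ DRel M j g

/-- `M` is fundamental: only idempotents commute with every idempotent. -/
def Fundamental (M : InvMonData S) : Prop :=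
  ∀ s, (∀ e, IsIdem M e → M.mul s e = M.mul e s) → IsIdem M s

/-- `M` is factorizable: every element lies beneath a unit. -/
def Factorizable (M : InvMonData S) : Prop :=
  ∀ s, ∃ g, M.mul g (M.inv g) = M.one ∧ M.mul (M.inv g) g = M.one ∧ nle M s g

/-- All binary meets exist (`∧`-monoid). -/
def HasMeets (M : InvMonData S) : Prop := ∀ a b, ∃ m, IsMeet M a b m

/-- A morphism of Boolean inverse `∧`-monoids: a monoid homomorphism mapping zero to zero,
preserving binary compatible joins and binary meets. -/
def IsMorphism (M : InvMonData S) (N : InvMonData T) (f : S → T) : Prop :=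
  f M.one = N.one ∧ f M.zero = N.zero ∧
  (∀ a b, f (M.mul a b) = N.mul (f a) (f b)) ∧
  (∀ a b j, Compatible M a b → IsJoin M a b j → IsJoin N (f a) (f b) (f j)) ∧
  (∀ a b m, IsMeet M a b m → IsMeet N (f a) (f b) (f m))

end Coordinatization
namespace Coordinatization

namespace IsInverseMonoid

variable {S : Type} {M : InvMonData S}

theorem isIdem_mul (h : IsInverseMonoid M) {e f : S} (he : IsIdem M e) (hf : IsIdem M f) :
    IsIdem M (M.mul e f) := by
  have assoc := h.mul_assoc
  have inv₁ := h.inv_law₁ (M.mul e f)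
  have inv₂ := h.inv_law₂ (M.mul e f)
  have uniq := h.inv_unique
  unfold IsIdem at *
  obtain ⟨x, hx⟩ : ∃ x, x = M.inv (M.mul e f) := ⟨_, rfl⟩
  rw [← hx] at inv₁ inv₂
  have he' (y : S) : M.mul e (M.mul e y) = M.mul e y := by rw [← assoc, he]
  have hf' (y : S) : M.mul f (M.mul f y) = M.mul f y := by rw [← assoc, hf]
  have inv₂' (y : S) : M.mul x (M.mul e (M.mul f (M.mul x y))) = M.mul x y := by
    simpa only [assoc] using congrArg (M.mul · y) inv₂
  have hfxe : M.mul f (M.mul x e) = x := by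
    refine (uniq (M.mul e f) (M.mul f (M.mul x e)) ?_ ?_).trans hx.symm
    · simpa only [assoc, he', hf'] using inv₁
    · simp only [assoc, he', hf', inv₂']
  have hxx : M.mul x x = x := by
    calc M.mul x x = M.mul (M.mul f (M.mul x e)) (M.mul f (M.mul x e)) := by rw [hfxe]
      _ = M.mul f (M.mul x e) := by simp only [assoc, inv₂']
      _ = x := hfxe
  have hef : M.mul e f = x :=
    (uniq x _ inv₂ inv₁).trans (uniq x x (by rw [hxx, hxx]) (by rw [hxx, hxx])).symm
  rw [hef, hxx]

theorem idem_comm (h : IsInverseMonoid M) {e f : S} (he : IsIdem M e) (hf : IsIdem M f) :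
    M.mul e f = M.mul f e := by
  have hef := h.isIdem_mul he hf
  have hfe := h.isIdem_mul hf he
  have assoc := h.mul_assoc
  unfold IsIdem at *
  have he' (y : S) : M.mul e (M.mul e y) = M.mul e y := by rw [← assoc, he]
  have hf' (y : S) : M.mul f (M.mul f y) = M.mul f y := by rw [← assoc, hf]
  refine (h.inv_unique (M.mul e f) _ (by rw [hef, hef]) (by rw [hef, hef])).trans
    (h.inv_unique (M.mul e f) _ ?_ ?_).symm
  · simpa only [assoc, he', hf'] using hef
  · simpa only [assoc, he', hf'] using hfe

theorem isIdem_one (h : IsInverseMonoid M) : IsIdem M M.one := h.one_mul _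

theorem isIdem_zero (h : IsInverseMonoid M) : IsIdem M M.zero := h.zero_mul _

theorem nle_refl (h : IsInverseMonoid M) (a : S) : nle M a a :=
  ⟨M.one, h.isIdem_one, (h.mul_one a).symm⟩

theorem zero_nle (h : IsInverseMonoid M) (a : S) : nle M M.zero a :=
  ⟨M.zero, h.isIdem_zero, (h.mul_zero a).symm⟩

theorem nle_trans (h : IsInverseMonoid M) {a b c : S} (hab : nle M a b) (hbc : nle M b c) :
    nle M a c := by
  obtain ⟨e, he, rfl⟩ := hab
  obtain ⟨f, hf, rfl⟩ := hbc
  exact ⟨M.mul f e, h.isIdem_mul hf he, h.mul_assoc _ _ _⟩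

theorem nle_antisymm (h : IsInverseMonoid M) {a b : S} (hab : nle M a b) (hba : nle M b a) :
    a = b := by
  obtain ⟨e, he, hae⟩ := hab
  obtain ⟨f, hf, hbf⟩ := hba
  have hbf' : M.mul b f = b := by rw [hbf, h.mul_assoc, hf]
  calc a = M.mul (M.mul b f) e := by rw [hbf', hae]
    _ = M.mul (M.mul b e) f := by rw [h.mul_assoc, h.mul_assoc, h.idem_comm hf he]
    _ = b := by rw [← hae, ← hbf]

end IsInverseMonoid

variable {S T : Type} {M : InvMonData S} {N : InvMonData T} {θ : S → T}

/-- If a morphism has trivial kernel and identifies `m ≤ a` with `a`, then `a ≤ m`. -/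
theorem nle_of_nle_of_map_eq (hM : IsBooleanInverseMonoid M)
    (hzero : θ M.zero = N.zero) (hmul : ∀ a b, θ (M.mul a b) = N.mul (θ a) (θ b))
    (hker : ∀ a, θ a = N.zero → a = M.zero) {m a : S}
    (hma : nle M m a) (hθ : θ m = θ a) : nle M a m := by
  have hS := hM.invMon
  obtain ⟨e, he, rfl⟩ := hma
  obtain ⟨e', -, -, hee', hjoin⟩ := hM.compl_exists e he
  have hae' : M.mul a e' = M.zero := by
    apply hker
    rw [hmul, ← hθ, ← hmul, hS.mul_assoc, hee', hS.mul_zero, hzero]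
  have hj := hM.mul_join_left a e e' M.one hjoin
  rw [hae', hS.mul_one] at hj
  exact hj.2.2 _ (hS.nle_refl _) (hS.zero_nle _)

/-- A morphism with trivial kernel reflects equality to the natural partial order. -/
theorem nle_of_map_eq (hM : IsBooleanInverseMonoid M) (hMmeet : HasMeets M)
    (hN : IsInverseMonoid N) (hθ : IsMorphism M N θ)
    (hker : ∀ a, θ a = N.zero → a = M.zero) {a b : S} (hab : θ a = θ b) : nle M a b := by
  obtain ⟨-, hzero, hmul, -, hmeet⟩ := hθ
  obtain ⟨m, hm⟩ := hMmeet a b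
  have hθm := hmeet a b m hm
  rw [← hab] at hθm
  have hma : θ m = θ a :=
    hN.nle_antisymm hθm.1 (hθm.2.2 _ (hN.nle_refl _) (hN.nle_refl _))
  exact hM.invMon.nle_trans (nle_of_nle_of_map_eq hM hzero hmul hker hm.1 hma) hm.2.1

/-- A morphism `θ : S → T` between Boolean inverse `∧`-monoids is injective if, and only
if, its kernel `θ⁻¹(0)` is `{0}`. -/
theorem morphism_injective_iff_kernel_zero {S T : Type}
    (M : InvMonData S) (N : InvMonData T)
    (hM : IsBooleanInverseMonoid M) (hMmeet : HasMeets M)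
    (hN : IsBooleanInverseMonoid N) (hNmeet : HasMeets N)
    (θ : S → T) (hθ : IsMorphism M N θ) :
    Function.Injective θ ↔ ∀ a, θ a = N.zero → a = M.zero := by
  refine ⟨fun hinj a ha => hinj (ha.trans hθ.2.1.symm), fun hker a b hab => ?_⟩
  exact hM.invMon.nle_antisymm (nle_of_map_eq hM hMmeet hN.invMon hθ hker hab)
    (nle_of_map_eq hM hMmeet hN.invMon hθ hker hab.symm)

end Coordinatization
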